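/- Let φ be a norm on ℝ² that is C² on ℝ²∖{0} and such that φ² is uniformly convex, and let ψ : ℝ² → [0,∞) be a continuous anisotropy. Then there exist constants 0 < c̄₁ ≤ c̄₂ such that c̄₁ ≤ (1+t²) · ψ(−t,1) · φ_xx(−t,1) ≤ c̄₂ for every t ∈ ℝ. -/

import Mathlib

open Set

/-- Partial derivative with respect to the first variable. -/
noncomputable def pdx (φ : ℝ × ℝ → ℝ) (p : ℝ × ℝ) : ℝ :=
  deriv (fun a => φ (a, p.2)) p.1

/-- `φ : ℝ² → [0,∞)` is a norm: convex, positively 1-homogeneous, symmetric and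
positive away from the origin. -/
def IsNorm2 (φ : ℝ × ℝ → ℝ) : Prop :=
  ConvexOn ℝ Set.univ φ ∧ (∀ c : ℝ, 0 < c → ∀ p, φ (c • p) = c * φ p) ∧
    (∀ p, φ (-p) = φ p) ∧ (∀ p : ℝ × ℝ, p ≠ 0 → 0 < φ p)

/-- An anisotropy: convex, positively 1-homogeneous and positive away from the
origin. -/
def IsAniso2 (ψ : ℝ × ℝ → ℝ) : Prop :=
  ConvexOn ℝ Set.univ ψ ∧ (∀ c : ℝ, 0 < c → ∀ p, ψ (c • p) = c * ψ p) ∧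
    (∀ p : ℝ × ℝ, p ≠ 0 → 0 < ψ p)

/-- `φ²` is uniformly convex. -/
def UnifConvexSq (φ : ℝ × ℝ → ℝ) : Prop :=
  ∃ m : ℝ, 0 < m ∧ ∀ p : ℝ × ℝ, p ≠ 0 → ∀ v : ℝ × ℝ,
    m * (v.1 ^ 2 + v.2 ^ 2) ≤
      (fderiv ℝ (fun q => fderiv ℝ (fun r => φ r ^ 2) q) p v) v

open Filter Topology

lemma aux_F {φ : ℝ × ℝ → ℝ} (hreg : ContDiffOn ℝ 2 φ {(0 : ℝ × ℝ)}ᶜ) {p : ℝ × ℝ} (hp : p ≠ 0) :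
    ContDiffAt ℝ 2 φ p :=
  hreg.contDiffAt (isOpen_compl_singleton.mem_nhds hp)

lemma aux_d {φ : ℝ × ℝ → ℝ} (hreg : ContDiffOn ℝ 2 φ {(0 : ℝ × ℝ)}ᶜ) {p : ℝ × ℝ} (hp : p ≠ 0) :
    HasFDerivAt φ (fderiv ℝ φ p) p :=
  ((aux_F hreg hp).differentiableAt (by norm_num)).hasFDerivAt

lemma aux_H {φ : ℝ × ℝ → ℝ} (hreg : ContDiffOn ℝ 2 φ {(0 : ℝ × ℝ)}ᶜ) {p : ℝ × ℝ} (hp : p ≠ 0) :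
    HasFDerivAt (fderiv ℝ φ) (fderiv ℝ (fderiv ℝ φ) p) p :=
  (((aux_F hreg hp).fderiv_right (m := 1) (by norm_num)).differentiableAt
    (by norm_num)).hasFDerivAt

lemma aux_Hcont {φ : ℝ × ℝ → ℝ} (hreg : ContDiffOn ℝ 2 φ {(0 : ℝ × ℝ)}ᶜ) {p : ℝ × ℝ}
    (hp : p ≠ 0) : ContinuousAt (fderiv ℝ (fderiv ℝ φ)) p :=
  (((aux_F hreg hp).fderiv_right (m := 1) (by norm_num)).fderiv_right (m := 0)
    (by norm_num)).continuousAt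

lemma aux_hom {φ : ℝ × ℝ → ℝ} (hreg : ContDiffOn ℝ 2 φ {(0 : ℝ × ℝ)}ᶜ)
    (hh : ∀ c : ℝ, 0 < c → ∀ p, φ (c • p) = c * φ p) {p : ℝ × ℝ} (hp : p ≠ 0) {c : ℝ}
    (hc : 0 < c) : fderiv ℝ φ (c • p) = fderiv ℝ φ p := by
  have h1 := aux_d hreg (p := c • p) (smul_ne_zero hc.ne' hp)
  have h2 : HasFDerivAt (fun q : ℝ × ℝ => c • q) (c • ContinuousLinearMap.id ℝ (ℝ × ℝ)) p :=
    (hasFDerivAt_id p).const_smul c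
  have h3 := h1.comp p h2
  have h4 : HasFDerivAt (φ ∘ fun q : ℝ × ℝ => c • q) (c • fderiv ℝ φ p) p := by
    have := (aux_d hreg hp).const_smul c
    refine this.congr_of_eventuallyEq (Eventually.of_forall fun q => ?_)
    simp [hh c hc]
  have h5 := h3.unique h4
  ext v
  · have := DFunLike.congr_fun h5 (1, 0)
    simp [-Prod.smul_mk, hc.ne'] at this
    simpa using this
  · have := DFunLike.congr_fun h5 (0, 1)
    simp [-Prod.smul_mk, hc.ne'] at this
    simpa using this

lemma aux_H0 {φ : ℝ × ℝ → ℝ} (hreg : ContDiffOn ℝ 2 φ {(0 : ℝ × ℝ)}ᶜ)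
    (hh : ∀ c : ℝ, 0 < c → ∀ p, φ (c • p) = c * φ p) {p : ℝ × ℝ} (hp : p ≠ 0) :
    fderiv ℝ (fderiv ℝ φ) p p = 0 := by
  have h1 : HasDerivAt (fun c : ℝ => c • p) p 1 := by
    simpa using (hasDerivAt_id (1 : ℝ)).smul_const p
  have h2 : HasFDerivAt (fderiv ℝ φ) (fderiv ℝ (fderiv ℝ φ) p) ((fun c : ℝ => c • p) 1) := by
    simpa using aux_H hreg hp
  have h3 := h2.comp_hasDerivAt (1 : ℝ) h1
  have h4 : HasDerivAt (fderiv ℝ φ ∘ fun c : ℝ => c • p) 0 1 := by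
    refine (hasDerivAt_const (1 : ℝ) (fderiv ℝ φ p)).congr_of_eventuallyEq ?_
    filter_upwards [lt_mem_nhds (zero_lt_one' ℝ)] with c hc
    exact aux_hom hreg hh hp hc
  exact h3.unique h4

lemma aux_Hs {φ : ℝ × ℝ → ℝ} (hreg : ContDiffOn ℝ 2 φ {(0 : ℝ × ℝ)}ᶜ)
    (hh : ∀ c : ℝ, 0 < c → ∀ p, φ (c • p) = c * φ p) {p : ℝ × ℝ} (hp : p ≠ 0) {c : ℝ}
    (hc : 0 < c) (v : ℝ × ℝ) :
    c • fderiv ℝ (fderiv ℝ φ) (c • p) v = fderiv ℝ (fderiv ℝ φ) p v := by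
  have h1 := aux_H hreg (p := c • p) (smul_ne_zero hc.ne' hp)
  have h2 : HasFDerivAt (fun q : ℝ × ℝ => c • q) (c • ContinuousLinearMap.id ℝ (ℝ × ℝ)) p :=
    (hasFDerivAt_id p).const_smul c
  have h3 := h1.comp p h2
  have h4 : HasFDerivAt (fderiv ℝ φ ∘ fun q : ℝ × ℝ => c • q) (fderiv ℝ (fderiv ℝ φ) p) p := by
    refine (aux_H hreg hp).congr_of_eventuallyEq ?_
    filter_upwards [isOpen_compl_singleton.mem_nhds hp] with q hq
    exact aux_hom hreg hh hq hc
  have h5 := DFunLike.congr_fun (h3.unique h4) v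
  simpa only [ContinuousLinearMap.comp_apply, ContinuousLinearMap.smul_apply,
    ContinuousLinearMap.id_apply, map_smul] using h5

lemma aux_sq {φ : ℝ × ℝ → ℝ} (hreg : ContDiffOn ℝ 2 φ {(0 : ℝ × ℝ)}ᶜ)
    {p : ℝ × ℝ} (hp : p ≠ 0) (v : ℝ × ℝ) :
    (fderiv ℝ (fun q => fderiv ℝ (fun r => φ r ^ 2) q) p v) v =
      2 * φ p * fderiv ℝ (fderiv ℝ φ) p v v + 2 * (fderiv ℝ φ p v) ^ 2 := by
  have h1 : (fun q => fderiv ℝ (fun r => φ r ^ 2) q) =ᶠ[𝓝 p]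
      fun q => (2 * φ q) • fderiv ℝ φ q := by
    filter_upwards [isOpen_compl_singleton.mem_nhds hp] with q hq
    have := ((aux_d hreg hq).pow 2).fderiv
    simpa using this
  have h2 := (((aux_d hreg hp).const_mul 2).smul (aux_H hreg hp)).congr_of_eventuallyEq h1
  rw [h2.fderiv]
  simp
  ring

lemma aux_pdx {φ : ℝ × ℝ → ℝ} (hreg : ContDiffOn ℝ 2 φ {(0 : ℝ × ℝ)}ᶜ) (t : ℝ) :
    pdx (pdx φ) (t, 1) = fderiv ℝ (fderiv ℝ φ) (t, 1) (1, 0) (1, 0) := by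
  have hne : ∀ a : ℝ, ((a, 1) : ℝ × ℝ) ≠ 0 := fun a h => by simp [Prod.ext_iff] at h
  have hl : ∀ a : ℝ, HasDerivAt (fun a : ℝ => ((a, 1) : ℝ × ℝ)) (1, 0) a := fun a =>
    (hasDerivAt_id a).prodMk (hasDerivAt_const a (1 : ℝ))
  have h1 : ∀ a : ℝ, pdx φ (a, 1) = fderiv ℝ φ (a, 1) (1, 0) := by
    intro a
    have h : HasDerivAt (fun a : ℝ => φ (a, 1)) (fderiv ℝ φ (a, 1) (1, 0)) a :=
      HasFDerivAt.comp_hasDerivAt (f := fun a : ℝ => ((a, 1) : ℝ × ℝ)) a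
        (aux_d hreg (hne a)) (hl a)
    exact h.deriv
  have h2 : HasDerivAt (fun a : ℝ => fderiv ℝ φ (a, 1))
      (fderiv ℝ (fderiv ℝ φ) (t, 1) (1, 0)) t :=
    HasFDerivAt.comp_hasDerivAt (f := fun a : ℝ => ((a, 1) : ℝ × ℝ)) t
      (aux_H hreg (hne t)) (hl t)
  have h3 : HasDerivAt (fun a : ℝ => fderiv ℝ φ (a, 1) (1, 0))
      (fderiv ℝ (fderiv ℝ φ) (t, 1) (1, 0) (1, 0)) t := by
    have := h2.clm_apply (hasDerivAt_const t ((1, 0) : ℝ × ℝ))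
    rwa [map_zero, add_zero] at this
  have h4 : (fun a => pdx φ (a, 1)) = fun a => fderiv ℝ φ (a, 1) (1, 0) := funext h1
  have h5 : pdx (pdx φ) (t, 1) = deriv (fun a => pdx φ (a, 1)) t := by
    rw [pdx]
  rw [h5, h4, h3.deriv]

lemma aux_quad {φ : ℝ × ℝ → ℝ} (hreg : ContDiffOn ℝ 2 φ {(0 : ℝ × ℝ)}ᶜ)
    (hh : ∀ c : ℝ, 0 < c → ∀ p, φ (c • p) = c * φ p) {p : ℝ × ℝ} (hp : p ≠ 0)
    (a b : ℝ) (w : ℝ × ℝ) :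
    fderiv ℝ (fderiv ℝ φ) p (a • p + b • w) (a • p + b • w) =
      b ^ 2 * fderiv ℝ (fderiv ℝ φ) p w w := by
  have hs : fderiv ℝ (fderiv ℝ φ) p w p = fderiv ℝ (fderiv ℝ φ) p p w :=
    ((aux_F hreg hp).isSymmSndFDerivAt (by simp)) w p
  rw [aux_H0 hreg hh hp] at hs
  simp only [map_add, map_smul, aux_H0 hreg hh hp, ContinuousLinearMap.add_apply,
    ContinuousLinearMap.smul_apply, hs]
  simp
  ring

lemma aux_pos {φ : ℝ × ℝ → ℝ} (hnorm : IsNorm2 φ)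
    (hreg : ContDiffOn ℝ 2 φ {(0 : ℝ × ℝ)}ᶜ) (hconv : UnifConvexSq φ)
    {p : ℝ × ℝ} (hp : p ≠ 0) (hu : p.1 ^ 2 + p.2 ^ 2 = 1) :
    0 < fderiv ℝ (fderiv ℝ φ) p (-p.2, p.1) (-p.2, p.1) := by
  obtain ⟨-, hh, -, hpos⟩ := hnorm
  obtain ⟨m, hm, hc⟩ := hconv
  set w : ℝ × ℝ := (-p.2, p.1) with hw
  have key : ∀ a b : ℝ, (a • p + b • w).1 ^ 2 + (a • p + b • w).2 ^ 2 = a ^ 2 + b ^ 2 := by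
    intro a b
    simp [hw]
    linear_combination (a ^ 2 + b ^ 2) * hu
  obtain ⟨a, b, hab, hF⟩ : ∃ a b : ℝ, 0 < a ^ 2 + b ^ 2 ∧ fderiv ℝ φ p (a • p + b • w) = 0 := by
    by_cases h : fderiv ℝ φ p p = 0
    · exact ⟨1, 0, by norm_num, by simp [h]⟩
    · refine ⟨-fderiv ℝ φ p w, fderiv ℝ φ p p, by positivity, ?_⟩
      simp only [map_add, map_smul, smul_eq_mul]
      ring
  have h1 := hc p hp (a • p + b • w)
  rw [aux_sq hreg hp, hF, aux_quad hreg hh hp, key] at h1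
  have h2 : 0 < m * (a ^ 2 + b ^ 2) := by positivity
  have h3 := hpos p hp
  by_contra hcon
  push Not at hcon
  have : (2 * φ p * b ^ 2) * fderiv ℝ (fderiv ℝ φ) p w w ≤ 0 :=
    mul_nonpos_of_nonneg_of_nonpos (by positivity) hcon
  nlinarith

theorem stmt8 (φ ψ : ℝ × ℝ → ℝ)
    (hnorm : IsNorm2 φ)
    (hreg : ContDiffOn ℝ 2 φ {(0 : ℝ × ℝ)}ᶜ)
    (hconv : UnifConvexSq φ)
    (hψ : IsAniso2 ψ) (hψcont : Continuous ψ) :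
    ∃ c₁ c₂ : ℝ, 0 < c₁ ∧ c₁ ≤ c₂ ∧ ∀ t : ℝ,
      c₁ ≤ (1 + t ^ 2) * ψ (-t, 1) * pdx (pdx φ) (-t, 1) ∧
      (1 + t ^ 2) * ψ (-t, 1) * pdx (pdx φ) (-t, 1) ≤ c₂ := by
  have hh := hnorm.2.1
  set K : Set (ℝ × ℝ) := {p | p.1 ^ 2 + p.2 ^ 2 = 1} with hK
  have hKc : IsCompact K := by
    refine (isCompact_Icc (a := ((-1, -1) : ℝ × ℝ)) (b := (1, 1))).of_isClosed_subset
      (isClosed_eq (by fun_prop) (by fun_prop)) ?_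
    intro p hp
    simp only [hK, mem_setOf_eq] at hp
    simp only [mem_Icc, Prod.le_def]
    refine ⟨⟨?_, ?_⟩, ?_, ?_⟩ <;> nlinarith [sq_nonneg p.1, sq_nonneg p.2]
  have hK0 : ∀ p ∈ K, p ≠ 0 := by
    rintro p hp rfl
    simp [hK] at hp
  have hKn : K.Nonempty := ⟨(1, 0), by simp [hK]⟩
  set f : ℝ × ℝ → ℝ := fun p => ψ p * fderiv ℝ (fderiv ℝ φ) p (-p.2, p.1) (-p.2, p.1) with hf
  have hfc : ContinuousOn f K := by
    intro p hp
    refine ContinuousAt.continuousWithinAt ?_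
    have h := aux_Hcont hreg (hK0 p hp)
    have hw : ContinuousAt (fun p : ℝ × ℝ => ((-p.2, p.1) : ℝ × ℝ)) p := by fun_prop
    exact hψcont.continuousAt.mul ((h.clm_apply hw).clm_apply hw)
  obtain ⟨p₁, hp₁, h₁⟩ := hKc.exists_isMinOn hKn hfc
  obtain ⟨p₂, hp₂, h₂⟩ := hKc.exists_isMaxOn hKn hfc
  refine ⟨f p₁, f p₂, mul_pos (hψ.2.2 _ (hK0 _ hp₁)) (aux_pos hnorm hreg hconv (hK0 _ hp₁) hp₁),
    h₁ hp₂, fun t => ?_⟩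
  set r := Real.sqrt (1 + t ^ 2) with hr
  have hr0 : 0 < r := Real.sqrt_pos.2 (by positivity)
  have hr2 : r ^ 2 = 1 + t ^ 2 := Real.sq_sqrt (by positivity)
  set u : ℝ × ℝ := (-t / r, 1 / r) with hu
  have huK : u ∈ K := by
    simp only [hK, hu, mem_setOf_eq]
    field_simp
    linarith
  have hru : r • u = (-t, 1) := by
    simp only [hu, Prod.smul_mk, smul_eq_mul]
    congr 1 <;> field_simp
  have hu0 := hK0 u huK
  suffices hmain : (1 + t ^ 2) * ψ (-t, 1) * pdx (pdx φ) (-t, 1) = f u by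
    rw [hmain]
    exact ⟨h₁ huK, h₂ huK⟩
  have he : ((1, 0) : ℝ × ℝ) = (-t / r) • u + (-(1 / r)) • ((-u.2, u.1) : ℝ × ℝ) := by
    simp only [hu, Prod.smul_mk, smul_eq_mul, Prod.mk_add_mk]
    congr 1
    · field_simp
      linarith
    · field_simp
      ring
  have hs := congrArg (fun L => L ((1, 0) : ℝ × ℝ)) (aux_Hs hreg hh hu0 hr0 (1, 0))
  simp only [hru, ContinuousLinearMap.smul_apply, smul_eq_mul] at hs
  have hq := aux_quad hreg hh hu0 (-t / r) (-(1 / r)) (-u.2, u.1)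
  rw [← he] at hq
  rw [hq] at hs
  have hψu := hψ.2.1 r hr0 u
  rw [hru] at hψu
  rw [aux_pdx hreg, hψu, ← hr2, hf]
  simp only
  set G := fderiv ℝ (fderiv ℝ φ) u (-u.2, u.1) (-u.2, u.1)
  set A := fderiv ℝ (fderiv ℝ φ) (-t, 1) (1, 0) (1, 0)
  have : r ^ 2 * (-(1 / r)) ^ 2 = 1 := by field_simp
  calc r ^ 2 * (r * ψ u) * A = r ^ 2 * ψ u * (r * A) := by ring
    _ = (r ^ 2 * (-(1 / r)) ^ 2) * (ψ u * G) := by rw [hs]; ring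
    _ = ψ u * G := by rw [this, one_mul]
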